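/- Let n, p be positive integers, α_N, α_a, ω, ω̄, γ, γ̄ > 0, σ ≥ 0, c ≥ 0, d̄_a ≥ 0, and suppose the 2×2 symmetric matrix [[-2α_N/ω̄, c], [c, -2σ]] ⪯ -2α_a·diag(1/ω, 1/γ) in the Loewner order. Let e : [0, ∞) → ℝⁿ and θ̃ : [0, ∞) → ℝᵖ be functions, let M : [0, ∞) → (real symmetric n×n matrices) satisfy (1/ω̄)·I ⪯ M(t) ⪯ (1/ω)·I for all t, let Γ be a real symmetric positive definite p×p matrix with γ·I ⪯ Γ ⪯ γ̄·I, and define V(t) = e(t)ᵀM(t)e(t) + θ̃(t)ᵀΓ⁻¹θ̃(t). Assume V is differentiable with V'(t) ≤ 2·(-(α_N/ω̄)‖e(t)‖² + c‖e(t)‖‖θ̃(t)‖ - σ‖θ̃(t)‖² + d̄_a·√(V(t))) for all t ≥ 0. Then for all t ≥ 0, ‖e(t)‖ ≤ √ω̄·(√(V(0))·e^{-α_a t} + (d̄_a/α_a)·(1 - e^{-α_a t})). -/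

import Mathlib

open Matrix

/-- Comparison principle for `V' ≤ -2 a V + 2 d √V`, in terms of the square root of `V`. -/
theorem sqrt_le_of_deriv_le_neg_mul_add_sqrt {a d : ℝ} (ha : 0 < a) (hd : 0 ≤ d) {V V' : ℝ → ℝ}
    (hV0 : 0 ≤ V 0)
    (hderiv : ∀ t, 0 ≤ t → HasDerivWithinAt V (V' t) (Set.Ici 0) t)
    (hle : ∀ t, 0 ≤ t → V' t ≤ -2 * a * V t + 2 * d * √(V t)) {t : ℝ} (ht : 0 ≤ t) :
    √(V t) ≤ √(V 0) * Real.exp (-a * t) + d / a * (1 - Real.exp (-a * t)) := by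
  set W : ℝ → ℝ := fun s => √(V 0) * Real.exp (-a * s) + d / a * (1 - Real.exp (-a * s)) with hW
  have hW_nonneg (s : ℝ) (hs : 0 ≤ s) : 0 ≤ W s := by
    have h : Real.exp (-a * s) ≤ 1 := Real.exp_le_one_iff.2 (by nlinarith)
    have h' : 0 ≤ 1 - Real.exp (-a * s) := by linarith
    positivity
  have hW_deriv (s : ℝ) : HasDerivAt W (-a * W s + d) s := by
    have hexp : HasDerivAt (fun s => Real.exp (-a * s)) (Real.exp (-a * s) * (-a)) s := by
      simpa using ((hasDerivAt_id s).const_mul (-a)).exp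
    refine ((hexp.const_mul √(V 0)).add ((hexp.const_sub 1).const_mul (d / a))).congr_deriv ?_
    simp only [hW]
    field_simp
    ring
  refine le_of_forall_pos_le_add fun ε hε => ?_
  have hsq : V t ≤ (W t + ε) ^ 2 := by
    refine image_le_of_deriv_right_lt_deriv_boundary (f := V) (f' := V') (a := 0) (b := t)
      (B := fun s => (W s + ε) ^ 2) (B' := fun s => 2 * (W s + ε) * (-a * W s + d))
      (fun s hs => ((hderiv s hs.1).continuousWithinAt).mono Set.Icc_subset_Ici_self)
      (fun s hs => (hderiv s hs.1).mono (Set.Ici_subset_Ici.2 hs.1)) ?_ (fun s => ?_)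
      (fun s hs heq => ?_) (Set.right_mem_Icc.2 ht)
    · have h0 : W 0 = √(V 0) := by simp [hW]
      have hs := Real.sq_sqrt hV0
      have hn := Real.sqrt_nonneg (V 0)
      rw [h0]
      nlinarith
    · simpa using ((hW_deriv s).add_const ε).fun_pow 2
    · have hpos : 0 < W s + ε := by linarith [hW_nonneg s hs.1]
      have h := hle s hs.1
      rw [heq, Real.sqrt_sq hpos.le] at h
      have : 0 < a * ε * (W s + ε) := by positivity
      nlinarith
  exact (Real.sqrt_le_sqrt hsq).trans_eq (Real.sqrt_sq (by linarith [hW_nonneg t ht]))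

theorem EuclideanSpace.dotProduct_self_eq_norm_sq {ι : Type*} [Fintype ι]
    (x : EuclideanSpace ℝ ι) : x ⬝ᵥ x = ‖x‖ ^ 2 := by
  rw [EuclideanSpace.real_norm_sq_eq]
  simp [dotProduct, sq]

theorem Matrix.PosSemidef.mul_dotProduct_self_le {ι : Type*} [Fintype ι] [DecidableEq ι]
    {A : Matrix ι ι ℝ} {k : ℝ} (h : (A - k • (1 : Matrix ι ι ℝ)).PosSemidef) (x : ι → ℝ) :
    k * (x ⬝ᵥ x) ≤ x ⬝ᵥ A *ᵥ x := by
  have := h.dotProduct_mulVec_nonneg x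
  simpa [sub_mulVec, smul_mulVec, dotProduct_sub] using this

theorem Matrix.PosSemidef.dotProduct_mulVec_le {ι : Type*} [Fintype ι] [DecidableEq ι]
    {A : Matrix ι ι ℝ} {k : ℝ} (h : (k • (1 : Matrix ι ι ℝ) - A).PosSemidef) (x : ι → ℝ) :
    x ⬝ᵥ A *ᵥ x ≤ k * (x ⬝ᵥ x) := by
  have := h.dotProduct_mulVec_nonneg x
  simpa [sub_mulVec, smul_mulVec, dotProduct_sub] using this

theorem Matrix.PosSemidef.dotProduct_inv_mulVec_le {ι : Type*} [Fintype ι] [DecidableEq ι]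
    {A : Matrix ι ι ℝ} {k : ℝ} (hk : 0 < k) (hA : IsUnit A.det)
    (h : (A - k • (1 : Matrix ι ι ℝ)).PosSemidef) (x : ι → ℝ) :
    x ⬝ᵥ A⁻¹ *ᵥ x ≤ 1 / k * (x ⬝ᵥ x) := by
  set u := A⁻¹ *ᵥ x with hu
  have hAu : A *ᵥ u = x := by rw [hu, mulVec_mulVec, mul_nonsing_inv _ hA, one_mulVec]
  have hlow := h.mul_dotProduct_self_le u
  rw [hAu, dotProduct_comm u x] at hlow
  have hsq : 0 ≤ (x - k • u) ⬝ᵥ (x - k • u) :=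
    Finset.sum_nonneg fun i _ => mul_self_nonneg _
  simp only [dotProduct_sub, sub_dotProduct, smul_dotProduct, dotProduct_smul, smul_eq_mul,
    dotProduct_comm u x] at hsq
  rw [one_div_mul_eq_div, le_div_iff₀ hk]
  nlinarith

/-- the shared analytic core of Theorems 2–4 of the adaptive NCM framework:
under the LMI condition (14)/(27) and the Lyapunov derivative inequality, the tracking
error satisfies the exponential bound (15). -/
theorem stmt_9 (n p : ℕ) (hn : 0 < n) (hp : 0 < p)
    (αN αa ω ωb γ γb : ℝ)
    (hαN : 0 < αN) (hαa : 0 < αa) (hω : 0 < ω) (hωb : 0 < ωb) (hγ : 0 < γ) (hγb : 0 < γb)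
    (σ c da : ℝ) (hσ : 0 ≤ σ) (hc : 0 ≤ c) (hda : 0 ≤ da)
    (hLMI : (((-2 * αa) • Matrix.diagonal ![1 / ω, 1 / γ] -
        !![-2 * αN / ωb, c; c, -2 * σ])).PosSemidef)
    (e : ℝ → EuclideanSpace ℝ (Fin n)) (θt : ℝ → EuclideanSpace ℝ (Fin p))
    (M : ℝ → Matrix (Fin n) (Fin n) ℝ)
    (hMsymm : ∀ t, 0 ≤ t → (M t).IsHermitian)
    (hMlb : ∀ t, 0 ≤ t → ((M t) - (1 / ωb) • (1 : Matrix (Fin n) (Fin n) ℝ)).PosSemidef)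
    (hMub : ∀ t, 0 ≤ t → ((1 / ω) • (1 : Matrix (Fin n) (Fin n) ℝ) - M t).PosSemidef)
    (Γ : Matrix (Fin p) (Fin p) ℝ) (hΓ : Γ.PosDef)
    (hΓlb : (Γ - γ • (1 : Matrix (Fin p) (Fin p) ℝ)).PosSemidef)
    (hΓub : (γb • (1 : Matrix (Fin p) (Fin p) ℝ) - Γ).PosSemidef)
    (V V' : ℝ → ℝ)
    (hV : ∀ t, 0 ≤ t → V t = e t ⬝ᵥ (M t).mulVec (e t) + θt t ⬝ᵥ Γ⁻¹.mulVec (θt t))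
    (hderiv : ∀ t, 0 ≤ t → HasDerivWithinAt V (V' t) (Set.Ici 0) t)
    (hineq : ∀ t, 0 ≤ t → V' t ≤
      2 * (-(αN / ωb) * ‖e t‖ ^ 2 + c * ‖e t‖ * ‖θt t‖ - σ * ‖θt t‖ ^ 2
        + da * Real.sqrt (V t))) :
    ∀ t, 0 ≤ t →
      ‖e t‖ ≤ Real.sqrt ωb *
        (Real.sqrt (V 0) * Real.exp (-αa * t) + (da / αa) * (1 - Real.exp (-αa * t))) := by
  have hVlow (t : ℝ) (ht : 0 ≤ t) : 1 / ωb * ‖e t‖ ^ 2 ≤ V t := by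
    have h₁ := (hMlb t ht).mul_dotProduct_self_le (e t)
    have h₂ := hΓ.inv.posSemidef.dotProduct_mulVec_nonneg (θt t)
    rw [EuclideanSpace.dotProduct_self_eq_norm_sq] at h₁
    rw [star_trivial] at h₂
    linarith [hV t ht]
  have hVup (t : ℝ) (ht : 0 ≤ t) : V t ≤ 1 / ω * ‖e t‖ ^ 2 + 1 / γ * ‖θt t‖ ^ 2 := by
    have h₁ := (hMub t ht).dotProduct_mulVec_le (e t)
    have h₂ := hΓlb.dotProduct_inv_mulVec_le hγ hΓ.det_pos.ne'.isUnit (θt t)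
    rw [EuclideanSpace.dotProduct_self_eq_norm_sq] at h₁ h₂
    linarith [hV t ht]
  have hquad (x y : ℝ) : -(αN / ωb) * x ^ 2 + c * x * y - σ * y ^ 2 ≤
      -αa * (1 / ω * x ^ 2 + 1 / γ * y ^ 2) := by
    have h := hLMI.dotProduct_mulVec_nonneg ![x, y]
    simp [dotProduct, mulVec, Fin.sum_univ_two] at h
    ring_nf at h ⊢
    linarith
  intro t ht
  have hV0 : 0 ≤ V 0 := le_trans (by positivity) (hVlow 0 le_rfl)
  have hsqrt := sqrt_le_of_deriv_le_neg_mul_add_sqrt hαa hda hV0 hderiv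
    (fun s hs => by
      have h := mul_le_mul_of_nonneg_left (hVup s hs) hαa.le
      linarith [hineq s hs, hquad ‖e s‖ ‖θt s‖]) ht
  calc ‖e t‖ ≤ √(ωb * V t) := Real.le_sqrt_of_sq_le (by
        have h := hVlow t ht
        rwa [one_div_mul_eq_div, div_le_iff₀' hωb] at h)
    _ = √ωb * √(V t) := Real.sqrt_mul hωb.le _
    _ ≤ _ := mul_le_mul_of_nonneg_left hsqrt (Real.sqrt_nonneg _)
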